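/- Let $1<p<\infty$ and let $w$ be a Muckenhoupt $A_p$ weight on $\mathbb{R}^n$. If $w^\beta$ is an $A_1$ weight for some $\beta>0$, then $w$ itself is an $A_1$ weight. -/

import Mathlib

open MeasureTheory Metric Set

noncomputable section

/-- An axis-parallel half-open cube in `ℝⁿ`, given by its lower corner and side length. -/
structure Cube (n : ℕ) where
  a : EuclideanSpace ℝ (Fin n)
  l : ℝ
  pos : 0 < l

/-- The set of points of a cube. -/
def Cube.set {n : ℕ} (P : Cube n) : Set (EuclideanSpace ℝ (Fin n)) :=
  {x | ∀ i, P.a i ≤ x i ∧ x i < P.a i + P.l}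

/-- A weight: locally integrable and a.e. positive. -/
def IsWeight {n : ℕ} (w : EuclideanSpace ℝ (Fin n) → ℝ) : Prop :=
  LocallyIntegrable w volume ∧ ∀ᵐ x ∂(volume : Measure (EuclideanSpace ℝ (Fin n))), 0 < w x

/-- The `A₁` inequality with constant `C`, over all axis-parallel cubes. -/
def A1With {n : ℕ} (w : EuclideanSpace ℝ (Fin n) → ℝ) (C : ℝ) : Prop :=
  ∀ P : Cube n, (⨍ x in P.set, w x) ≤ C * essInf w (volume.restrict P.set)

/-- Membership in the Muckenhoupt class `A₁`. -/
def MemA1 {n : ℕ} (w : EuclideanSpace ℝ (Fin n) → ℝ) : Prop :=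
  IsWeight w ∧ ∃ C : ℝ, A1With w C

/-- The `A_p` inequality with constant `C`, over all axis-parallel cubes. -/
def ApWith {n : ℕ} (w : EuclideanSpace ℝ (Fin n) → ℝ) (p C : ℝ) : Prop :=
  ∀ P : Cube n,
    (⨍ x in P.set, w x) * (⨍ x in P.set, w x ^ (1 / (1 - p))) ^ (p - 1) ≤ C

/-- Membership in the Muckenhoupt class `A_p`. -/
def MemAp {n : ℕ} (w : EuclideanSpace ℝ (Fin n) → ℝ) (p : ℝ) : Prop :=
  IsWeight w ∧ ∃ C : ℝ, ApWith w p C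

/-- `Q` is a dyadic subcube of `P`. -/
def IsDyadicSubcube {n : ℕ} (P Q : Cube n) : Prop :=
  ∃ (j : ℕ) (k : Fin n → ℕ), (∀ i, k i < 2 ^ j) ∧
    Q.l = P.l / 2 ^ j ∧ ∀ i, Q.a i = P.a i + P.l * k i / 2 ^ j

/-- A cube is `E`-free if it does not meet `E`. -/
def EFree {n : ℕ} (E : Set (EuclideanSpace ℝ (Fin n))) (Q : Cube n) : Prop :=
  Q.set ∩ E = ∅

/-- The measure `|𝓜(P)|` of a largest `E`-free dyadic subcube of `P`
(`0` if there is none). -/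
def maxFree {n : ℕ} (E : Set (EuclideanSpace ℝ (Fin n))) (P : Cube n) : ℝ :=
  sSup {v : ℝ | ∃ Q : Cube n, IsDyadicSubcube P Q ∧ EFree E Q ∧ v = (volume Q.set).toReal}

/-- Weak porosity with constants `c`, `δ`. -/
def WeaklyPorousWith {n : ℕ} (E : Set (EuclideanSpace ℝ (Fin n))) (c δ : ℝ) : Prop :=
  ∀ P : Cube n, ∃ (N : ℕ) (Q : Fin N → Cube n),
    (∀ k, IsDyadicSubcube P (Q k) ∧ EFree E (Q k)) ∧
    (∀ k m, k ≠ m → Disjoint (Q k).set (Q m).set) ∧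
    (∀ k, δ * maxFree E P ≤ (volume (Q k).set).toReal) ∧
    c * (volume P.set).toReal ≤ ∑ k, (volume (Q k).set).toReal

/-- A set is weakly porous if it is weakly porous with some constants `0 < c, δ < 1`. -/
def WeaklyPorous {n : ℕ} (E : Set (EuclideanSpace ℝ (Fin n))) : Prop :=
  ∃ c δ : ℝ, 0 < c ∧ c < 1 ∧ 0 < δ ∧ δ < 1 ∧ WeaklyPorousWith E c δ

/-- Porosity. -/
def Porous {n : ℕ} (E : Set (EuclideanSpace ℝ (Fin n))) : Prop :=
  ∃ c : ℝ, 0 < c ∧ ∀ (x : EuclideanSpace ℝ (Fin n)) (r : ℝ), 0 < r →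
    ∃ y : EuclideanSpace ℝ (Fin n), ball y (c * r) ⊆ ball x r \ E

/-- The distance weight `dist(·,E)^{-α}`. -/
def distw {n : ℕ} (E : Set (EuclideanSpace ℝ (Fin n))) (α : ℝ)
    (x : EuclideanSpace ℝ (Fin n)) : ℝ :=
  infDist x E ^ (-α)

/-- `h_E(B(x,R))`: the supremum of radii `t` of balls contained in `B(x,R) \ E`. -/
def hFree {n : ℕ} (E : Set (EuclideanSpace ℝ (Fin n))) (x : EuclideanSpace ℝ (Fin n))
    (R : ℝ) : ℝ :=
  sSup {t : ℝ | ∃ y ∈ ball x R, ball y t ⊆ ball x R \ E}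

/-- The set of admissible exponents in the definition of the Muckenhoupt exponent. -/
def MuckSet {n : ℕ} (E : Set (EuclideanSpace ℝ (Fin n))) : Set ℝ :=
  {α : ℝ | ∃ C : ℝ, ∀ x ∈ E, ∀ R r : ℝ, 0 < r → r < hFree E x R → hFree E x R ≤ R →
    (volume (thickening r E ∩ ball x R)).toReal ≤
      C * (hFree E x R / r) ^ (-α) * (volume (ball x R)).toReal}

open scoped Classical in
/-- The Muckenhoupt exponent of `E`. -/
def MuckExp {n : ℕ} (E : Set (EuclideanSpace ℝ (Fin n))) : ℝ :=
  if ∀ x ∈ E, ∀ R : ℝ, 0 < R → 0 < hFree E x R then sSup (MuckSet E) else 0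

end

/-- The power function with a nonpositive exponent is convex on the positive half-line. -/
theorem convexOn_rpow_of_nonpos {q : ℝ} (hq : q ≤ 0) :
    ConvexOn ℝ (Ioi 0) fun x : ℝ => x ^ q := by
  have hlog : ConvexOn ℝ (Ioi 0) fun x : ℝ => Real.log x * q := by
    have h := strictConcaveOn_log_Ioi.concaveOn.neg.smul (neg_nonneg.2 hq)
    refine h.congr fun x _ => ?_
    simp [mul_comm]
  refine ⟨convex_Ioi 0, fun x hx y hy a b ha hb hab => ?_⟩
  have hxy := (convex_Ioi (0 : ℝ)) hx hy ha hb hab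
  rw [mem_Ioi] at hx hy hxy
  simp only [Real.rpow_def_of_pos hx, Real.rpow_def_of_pos hy, Real.rpow_def_of_pos hxy]
  exact (Real.exp_le_exp.2 (hlog.2 hx hy ha hb hab)).trans
    (convexOn_exp.2 (mem_univ _) (mem_univ _) ha hb hab)

section RealEssInf

variable {α : Type*} [MeasurableSpace α] {μ : Measure α}

/-- A real function is frequently bounded above with respect to a nonzero measure. -/
theorem isCoboundedUnder_ge_ae_real [NeZero μ] (f : α → ℝ) :
    Filter.IsCoboundedUnder (· ≥ ·) (ae μ) f := by
  by_contra h
  have key : ∀ k : ℕ, ∀ᵐ x ∂μ, (k : ℝ) < f x := by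
    intro k
    by_contra hk
    refine h (Filter.IsCoboundedUnder.of_frequently_le (a := (k : ℝ)) ?_)
    simpa only [Filter.Frequently, not_le] using hk
  obtain ⟨x, hx⟩ := (ae_all_iff.2 key).exists
  obtain ⟨k, hk⟩ := exists_nat_gt (f x)
  exact lt_asymm hk (hx k)

theorem le_essInf_real [NeZero μ] {f : α → ℝ} {c : ℝ} (h : ∀ᵐ x ∂μ, c ≤ f x) :
    c ≤ essInf f μ :=
  le_essInf_of_ae_le c h (isCoboundedUnder_ge_ae_real f)

theorem average_pos_of_ae_pos [IsFiniteMeasure μ] [NeZero μ] {f : α → ℝ}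
    (hf : Integrable f μ) (hpos : ∀ᵐ x ∂μ, 0 < f x) : 0 < ⨍ x, f x ∂μ := by
  rw [average_eq, smul_eq_mul]
  refine mul_pos (inv_pos.2 measureReal_univ_pos) ?_
  rw [integral_pos_iff_support_of_nonneg_ae (hpos.mono fun x hx => hx.le) hf]
  have : (Function.support f : Set α) =ᵐ[μ] univ :=
    Filter.eventuallyEq_univ.2 (hpos.mono fun x hx => hx.ne')
  rw [measure_congr this]
  exact NeZero.pos _

/-- A single average satisfying the `A_p` inequality for `w` and the `A₁` inequality for `w ^ β`
satisfies the `A₁` inequality for `w`. -/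
theorem average_le_of_ap_of_power_a1 [IsFiniteMeasure μ] [NeZero μ] {w : α → ℝ}
    {p β C D : ℝ} (hp : 1 < p) (hβ : 0 < β) (hpos : ∀ᵐ x ∂μ, 0 < w x)
    (hint : Integrable (fun x => w x ^ β) μ)
    (hAp : (⨍ x, w x ∂μ) * (⨍ x, w x ^ (1 / (1 - p)) ∂μ) ^ (p - 1) ≤ C)
    (hA1 : (⨍ x, w x ^ β ∂μ) ≤ D * essInf (fun x => w x ^ β) μ) :
    (⨍ x, w x ∂μ) ≤ C * D ^ (1 / β) * essInf w μ := by
  set m := essInf (fun x => w x ^ β) μ with hm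
  set A := ⨍ x, w x ^ β ∂μ with hA
  set S := ⨍ x, w x ^ (1 / (1 - p)) ∂μ with hS
  have hAvg : 0 ≤ ⨍ x, w x ∂μ := integral_nonneg_of_ae
    (Measure.ae_smul_measure (hpos.mono fun x hx => hx.le) _)
  have hβpos : ∀ᵐ x ∂μ, 0 < w x ^ β := hpos.mono fun x hx => Real.rpow_pos_of_pos hx β
  have hApos : 0 < A := average_pos_of_ae_pos hint hβpos
  have hm0 : 0 ≤ m := le_essInf_real (hβpos.mono fun x hx => hx.le)
  have hmpos : 0 < m := hm0.lt_of_ne fun h => by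
    rw [← h, mul_zero] at hA1
    exact hApos.not_ge hA1
  have hD : 0 < D := pos_of_mul_pos_left (hApos.trans_le hA1) hm0
  have hmle : ∀ᵐ x ∂μ, m ≤ w x ^ β :=
    ae_essInf_le ⟨0, Filter.eventually_map.2 (hβpos.mono fun x hx => hx.le)⟩
  have hmInf : m ^ (1 / β) ≤ essInf w μ := by
    refine le_essInf_real ?_
    filter_upwards [hmle, hpos] with x hx hx0
    calc m ^ (1 / β) ≤ (w x ^ β) ^ (1 / β) := by gcongr
      _ = w x := by rw [← Real.rpow_mul hx0.le, mul_one_div_cancel hβ.ne', Real.rpow_one]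
  have hp0 : 0 < p - 1 := sub_pos.2 hp
  have hp1 : 1 - p ≠ 0 := by linarith
  set q := 1 / (1 - p) / β with hq
  have hq0 : q ≤ 0 := div_nonpos_of_nonpos_of_nonneg
    (div_nonpos_of_nonneg_of_nonpos zero_le_one (by linarith)) hβ.le
  have hsub : Ici m ⊆ Ioi 0 := fun x hx => hmpos.trans_le hx
  have hcont : ContinuousOn (fun x : ℝ => x ^ q) (Ici m) := fun x hx =>
    (Real.continuousAt_rpow_const x q (Or.inl (hsub hx).ne')).continuousWithinAt
  have hJensen : A ^ q ≤ S := by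
    have hgi : Integrable ((fun x : ℝ => x ^ q) ∘ fun x => w x ^ β) μ := by
      refine Integrable.of_bound (C := m ^ q)
        (hint.aestronglyMeasurable.aemeasurable.pow_const q).aestronglyMeasurable ?_
      filter_upwards [hmle] with x hx
      have hx0 := hmpos.trans_le hx
      rw [Function.comp_apply, Real.norm_of_nonneg (Real.rpow_nonneg hx0.le q)]
      exact Real.rpow_le_rpow_of_nonpos hmpos hx hq0
    have h := ((convexOn_rpow_of_nonpos hq0).subset hsub (convex_Ici m)).map_average_le
      hcont isClosed_Ici hmle hint hgi
    refine h.trans_eq (integral_congr_ae (Measure.ae_smul_measure ?_ _))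
    filter_upwards [hpos] with x hx
    rw [← Real.rpow_mul hx.le, hq, mul_div_cancel₀ _ hβ.ne']
  have hpow : A ^ (-(1 / β)) ≤ S ^ (p - 1) := by
    calc A ^ (-(1 / β)) = (A ^ q) ^ (p - 1) := by
          rw [← Real.rpow_mul hApos.le, hq]
          congr 1
          field_simp
          ring
      _ ≤ S ^ (p - 1) := by gcongr
  have hAp' : (⨍ x, w x ∂μ) * A ^ (-(1 / β)) ≤ C :=
    (mul_le_mul_of_nonneg_left hpow hAvg).trans hAp
  have hC : 0 ≤ C := (mul_nonneg hAvg (Real.rpow_nonneg hApos.le _)).trans hAp'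
  calc (⨍ x, w x ∂μ) = (⨍ x, w x ∂μ) * A ^ (-(1 / β)) * A ^ (1 / β) := by
        rw [mul_assoc, ← Real.rpow_add hApos, neg_add_cancel, Real.rpow_zero, mul_one]
    _ ≤ C * A ^ (1 / β) := by gcongr
    _ ≤ C * (D * m) ^ (1 / β) := by gcongr
    _ = C * D ^ (1 / β) * m ^ (1 / β) := by rw [Real.mul_rpow hD.le hm0, mul_assoc]
    _ ≤ C * D ^ (1 / β) * essInf w μ := by gcongr

end RealEssInf

namespace Cube

variable {n : ℕ} (P : Cube n)

theorem set_subset_image_Icc : P.set ⊆ WithLp.toLp 2 '' Icc (P.a : Fin n → ℝ)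
    (fun i => P.a i + P.l) :=
  fun x hx => ⟨x, ⟨fun i => (hx i).1, fun i => (hx i).2.le⟩, rfl⟩

theorem exists_isCompact_superset : ∃ K, IsCompact K ∧ P.set ⊆ K :=
  ⟨_, isCompact_Icc.image (PiLp.continuous_toLp 2 _), P.set_subset_image_Icc⟩

theorem volume_set_lt_top : volume P.set < ⊤ := by
  obtain ⟨K, hK, hPK⟩ := P.exists_isCompact_superset
  exact (measure_mono hPK).trans_lt hK.measure_lt_top

theorem volume_set_pos : 0 < volume P.set := by
  have hopen : IsOpen {x : EuclideanSpace ℝ (Fin n) | ∀ i, P.a i < x i ∧ x i < P.a i + P.l} := by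
    simp only [Set.ofPred_forall]
    refine isOpen_iInter_of_finite fun i => ?_
    have hcont : Continuous fun x : EuclideanSpace ℝ (Fin n) => x i := by fun_prop
    exact (isOpen_lt continuous_const hcont).inter (isOpen_lt hcont continuous_const)
  refine (hopen.measure_pos volume ⟨WithLp.toLp 2 fun i => P.a i + P.l / 2, fun i => ?_⟩).trans_le
    (measure_mono fun x hx i => ⟨(hx i).1.le, (hx i).2⟩)
  have := P.pos
  constructor <;> dsimp only <;> linarith

end Cube

/-- If `w ∈ A_p` for some `1 < p < ∞` and `w^β ∈ A₁` for some `β > 0`,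
then `w ∈ A₁`. -/
theorem ap_and_power_a1_implies_a1 {n : ℕ} (p : ℝ) (hp : 1 < p)
    (w : EuclideanSpace ℝ (Fin n) → ℝ) (hw : MemAp w p)
    (hβ : ∃ β : ℝ, 0 < β ∧ MemA1 (fun x => w x ^ β)) :
    MemA1 w := by
  obtain ⟨hw, C, hC⟩ := hw
  obtain ⟨β, hβ, ⟨hint, -⟩, D, hD⟩ := hβ
  refine ⟨hw, C * D ^ (1 / β), fun P => ?_⟩
  have : IsFiniteMeasure (volume.restrict P.set) := isFiniteMeasure_restrict.2 P.volume_set_lt_top.ne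
  have : NeZero (volume.restrict P.set) :=
    ⟨fun h => P.volume_set_pos.ne' (Measure.restrict_eq_zero.1 h)⟩
  obtain ⟨K, hK, hPK⟩ := P.exists_isCompact_superset
  exact average_le_of_ap_of_power_a1 hp hβ (ae_restrict_of_ae hw.2)
    ((hint.integrableOn_isCompact hK).mono_set hPK) (hC P) (hD P)
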